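/- Suppose F is a norm on ℝ^N, K ≥ 0 satisfies |d̄(x, x') − F(x − x')| ≤ K for all x, x' ∈ ℝ^N, and let λ := sup{|v|/F(v) : v ≠ 0} < ∞. Let (X, d_X) be the metric space obtained from (ℝ^N, d̄) by identifying points at d̄-distance zero, with quotient map π, and let x₀ := π(0). Then for every r > 0 and every R > 0 with K/R < r, the Gromov–Hausdorff distance between the closed ball B̄(x₀, Rr) ⊆ X with the rescaled metric d_X/R and the ball {v ∈ ℝ^N : F(v) ≤ r} with the norm metric d_F(u, v) := F(u − v) is at most √(8λr(K/R) + (K/R)²) + K/R. -/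

import Mathlib

open scoped ENNReal NNReal
open Metric Set Filter MeasureTheory

noncomputable section

abbrev E (N : ℕ) : Type := EuclideanSpace ℝ (Fin N)

/-- The set of costs of chains jumping through `m + 1` stitches (with consecutive
stitches distinct) from `v` to `w`. -/
def chainCosts {N : ℕ} {J : Type*} (I : J → Set (E N)) (m : ℕ) (v w : E N) :
    Set ℝ≥0∞ :=
  {c | ∃ (j : Fin (m + 1) → J) (z z' : Fin (m + 1) → E N),
    (∀ i, z i ∈ I (j i)) ∧ (∀ i, z' i ∈ I (j i)) ∧
    (∀ i : Fin m, j i.castSucc ≠ j i.succ) ∧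
    c = edist v (z 0) + (∑ i : Fin m, edist (z' i.castSucc) (z i.succ)) +
        edist (z' (Fin.last m)) w}

/-- `dk I k v w` is the infimum of lengths of paths from `v` to `w` jumping through
exactly `k` stitches (it is `∞` when no such chain exists). -/
def dk {N : ℕ} {J : Type*} (I : J → Set (E N)) : ℕ → E N → E N → ℝ≥0∞
  | 0 => fun v w => edist v w
  | (m + 1) => fun v w => sInf (chainCosts I m v w)

/-- The smocking pseudometric `d̄`. -/
def dbar {N : ℕ} {J : Type*} (I : J → Set (E N)) (v w : E N) : ℝ≥0∞ :=
  ⨅ k, dk I k v w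


theorem dbar_le_edist {N : ℕ} {J : Type*} (I : J → Set (E N)) (v w : E N) :
    dbar I v w ≤ edist v w :=
  iInf_le (fun k => dk I k v w) 0

/-- The metric obtained from a given one by dividing distances by `R > 0`. -/
abbrev MetricSpace.divDist {X : Type*} (m : MetricSpace X) (R : ℝ) (hR : 0 < R) :
    MetricSpace X where
  dist x y := dist x y / R
  dist_self x := by simp
  dist_comm x y := by simp only [dist_comm]
  dist_triangle x y z := by
    rw [← add_div]
    gcongr
    exact dist_triangle x y z
  eq_of_dist_eq_zero {x y} h := by
    rw [div_eq_zero_iff] at h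
    exact dist_eq_zero.mp (h.resolve_right hR.ne')

section HomogeneousNorm

variable {V : Type*} [AddCommGroup V] [Module ℝ V] {F : V → ℝ}

theorem map_zero_of_abs_homogeneous (hFsmul : ∀ (a : ℝ) (v : V), F (a • v) = |a| * F v) :
    F 0 = 0 := by
  simpa using hFsmul 0 0

theorem map_neg_of_abs_homogeneous (hFsmul : ∀ (a : ℝ) (v : V), F (a • v) = |a| * F v)
    (v : V) : F (-v) = F v := by
  simpa using hFsmul (-1) v

theorem nonneg_of_subadditive_of_abs_homogeneous (hFadd : ∀ u v : V, F (u + v) ≤ F u + F v)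
    (hFsmul : ∀ (a : ℝ) (v : V), F (a • v) = |a| * F v) (v : V) : 0 ≤ F v := by
  have h := hFadd v (-v)
  rw [add_neg_cancel, map_zero_of_abs_homogeneous hFsmul,
    map_neg_of_abs_homogeneous hFsmul] at h
  linarith

/-- The metric `(u, v) ↦ F (u - v)` of a norm `F`. -/
abbrev normMetric (F : V → ℝ) (hFadd : ∀ u v : V, F (u + v) ≤ F u + F v)
    (hFsmul : ∀ (a : ℝ) (v : V), F (a • v) = |a| * F v)
    (hFdef : ∀ v : V, F v = 0 → v = 0) : MetricSpace V where
  dist u v := F (u - v)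
  dist_self u := by
    rw [sub_self]
    exact map_zero_of_abs_homogeneous hFsmul
  dist_comm u v := by
    rw [← neg_sub]
    exact map_neg_of_abs_homogeneous hFsmul (v - u)
  dist_triangle u v w := by simpa using hFadd (u - v) (v - w)
  eq_of_dist_eq_zero {u v} h := sub_eq_zero.mp (hFdef _ h)

/-- If `F` exceeds a norm by at most an additive constant, then it is bounded by that norm. -/
theorem le_norm_of_le_norm_add_const {V : Type*} [NormedAddCommGroup V] [NormedSpace ℝ V]
    {F : V → ℝ} (hFsmul : ∀ (a : ℝ) (v : V), F (a • v) = |a| * F v) {K : ℝ}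
    (h : ∀ v, F v ≤ ‖v‖ + K) (v : V) : F v ≤ ‖v‖ := by
  by_contra! hv
  obtain ⟨n, hn⟩ := exists_nat_gt (K / (F v - ‖v‖))
  rw [div_lt_iff₀ (by linarith)] at hn
  have h' := h ((n : ℝ) • v)
  rw [hFsmul, norm_smul, Real.norm_eq_abs, Nat.abs_cast] at h'
  linarith

/-- Shrinking a vector from the ball of radius `r + ε` to the ball of radius `r` moves it by at
most `ε`. -/
theorem exists_le_and_sub_le {r ε : ℝ} (hr : 0 ≤ r) (hε : 0 ≤ ε) (hrε : 0 < r + ε)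
    (hFsmul : ∀ (a : ℝ) (v : V), F (a • v) = |a| * F v) {v : V} (hv : F v ≤ r + ε) :
    ∃ u, F u ≤ r ∧ F (v - u) ≤ ε := by
  have key : ∀ a : ℝ, 0 ≤ a → a / (r + ε) * F v ≤ a := fun a ha => by
    rw [div_mul_eq_mul_div, div_le_iff₀ hrε]
    exact mul_le_mul_of_nonneg_left hv ha
  refine ⟨(r / (r + ε)) • v, ?_, ?_⟩
  · rw [hFsmul, abs_of_nonneg (by positivity)]
    exact key r hr
  · have h : v - (r / (r + ε)) • v = (ε / (r + ε)) • v := by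
      rw [sub_eq_iff_eq_add, ← add_smul, ← add_div, add_comm ε, div_self hrε.ne', one_smul]
    rw [h, hFsmul, abs_of_nonneg (by positivity)]
    exact key ε hε

end HomogeneousNorm

/-- Two sets that are `η`-related through a pair of maps whose distance functions differ by at
most `2 * δ` are at Gromov–Hausdorff distance at most `η + δ`. -/
theorem exists_isometries_hausdorffDist_le {X Y W : Type} [MetricSpace X] [MetricSpace Y]
    [Nonempty W] (Φ : W → X) (Ψ : W → Y) {δ η : ℝ} (hδ : 0 ≤ δ) (hη : 0 ≤ η)
    (hdist : ∀ p q, |dist (Φ p) (Φ q) - dist (Ψ p) (Ψ q)| ≤ 2 * δ)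
    (hΦ : Function.Surjective Φ) {A : Set X} {B : Set Y}
    (hA : ∀ p, Φ p ∈ A → ∃ y ∈ B, dist (Ψ p) y ≤ η)
    (hB : ∀ y ∈ B, ∃ p, Φ p ∈ A ∧ dist (Ψ p) y ≤ η) :
    ∃ (Z : Type) (_ : MetricSpace Z) (f : X → Z) (g : Y → Z),
      Isometry f ∧ Isometry g ∧ hausdorffDist (f '' A) (g '' B) ≤ η + δ := by
  suffices h : ∃ (Z : Type) (_ : MetricSpace Z) (f : X → Z) (g : Y → Z),
      Isometry f ∧ Isometry g ∧ ∀ p, dist (f (Φ p)) (g (Ψ p)) ≤ δ by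
    obtain ⟨Z, _, f, g, hf, hg, hfg⟩ := h
    have hclose : ∀ p y, dist (Ψ p) y ≤ η → dist (f (Φ p)) (g y) ≤ η + δ := fun p y hy => by
      have := dist_triangle (f (Φ p)) (g (Ψ p)) (g y)
      rw [hg.dist_eq] at this
      linarith [hfg p]
    refine ⟨Z, _, f, g, hf, hg, hausdorffDist_le_of_mem_dist (by positivity) ?_ ?_⟩
    · rintro _ ⟨x, hx, rfl⟩
      obtain ⟨p, rfl⟩ := hΦ x
      obtain ⟨y, hy, hpy⟩ := hA p hx
      exact ⟨g y, mem_image_of_mem g hy, hclose p y hpy⟩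
    · rintro _ ⟨y, hy, rfl⟩
      obtain ⟨p, hp, hpy⟩ := hB y hy
      exact ⟨f (Φ p), mem_image_of_mem f hp, dist_comm (g y) _ ▸ hclose p y hpy⟩
  obtain rfl | hδ := hδ.eq_or_lt
  · have heq : ∀ p q, dist (Φ p) (Φ q) = dist (Ψ p) (Ψ q) := fun p q => by
      simpa [sub_eq_zero] using hdist p q
    obtain ⟨s, hs⟩ := hΦ.hasRightInverse
    refine ⟨Y, inferInstance, Ψ ∘ s, id, ?_, isometry_id, fun p => ?_⟩
    · exact Isometry.of_dist_eq fun x y => by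
        rw [Function.comp_apply, Function.comp_apply, ← heq, hs, hs]
    · rw [Function.comp_apply, id, ← heq, hs, dist_self]
  · let := glueMetricApprox Φ Ψ δ hδ hdist
    exact ⟨X ⊕ Y, this, Sum.inl, Sum.inr, Isometry.of_dist_eq fun _ _ => rfl,
      Isometry.of_dist_eq fun _ _ => rfl, fun p => (glueDist_glued_points Φ Ψ δ p).le⟩

/-- quantitative Gromov–Hausdorff estimate: the ball `B̄(x₀, R r)` of
the quotient space with the rescaled metric `d_X / R` is within GH distance
`√(8 λ r (K/R) + (K/R)²) + K/R` of the `F`-ball of radius `r`, witnessed by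
distance-preserving embeddings into a common metric space. -/
theorem smocking_GH_estimate
    {N : ℕ} (hN : 1 ≤ N) {J : Type} [Countable J] (I : J → Set (E N))
    (hne : ∀ j, (I j).Nonempty) (hcpt : ∀ j, IsCompact (I j))
    (hconn : ∀ j, IsConnected (I j))
    (hdisj : Pairwise fun j j' => Disjoint (I j) (I j'))
    (hsep : ∃ δ : ℝ, 0 < δ ∧ ∀ j j', j ≠ j' → ∀ z ∈ I j, ∀ z' ∈ I j', δ ≤ dist z z')
    (F : E N → ℝ)
    (hFadd : ∀ u v : E N, F (u + v) ≤ F u + F v)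
    (hFsmul : ∀ (a : ℝ) (v : E N), F (a • v) = |a| * F v)
    (hFdef : ∀ v : E N, F v = 0 → v = 0)
    (K : ℝ) (hK : 0 ≤ K)
    (hKd : ∀ x x' : E N, |(dbar I x x').toReal - F (x - x')| ≤ K)
    (lam : ℝ) (hlam : ∀ v : E N, ‖v‖ ≤ lam * F v)
    (X : Type) [MetricSpace X] (π : E N → X) (hπsurj : Function.Surjective π)
    (hπ : ∀ v w : E N, dist (π v) (π w) = (dbar I v w).toReal)
    (r : ℝ) (hr : 0 < r) (R : ℝ) (hR : 0 < R) (hKR : K / R < r) :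
    ∃ (Z : Type) (_ : MetricSpace Z) (f : X → Z) (g : E N → Z),
      (∀ x ∈ Metric.closedBall (π 0) (R * r),
        ∀ y ∈ Metric.closedBall (π 0) (R * r),
          dist (f x) (f y) = dist x y / R) ∧
      (∀ u ∈ {v : E N | F v ≤ r}, ∀ v ∈ {v : E N | F v ≤ r},
        dist (g u) (g v) = F (u - v)) ∧
      Metric.hausdorffDist (f '' Metric.closedBall (π 0) (R * r))
        (g '' {v : E N | F v ≤ r})
        ≤ Real.sqrt (8 * lam * r * (K / R) + (K / R) ^ 2) + K / R := by
  set ε := K / R with hε_def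
  have hε : 0 ≤ ε := by positivity
  have hdbar : ∀ v w : E N, |dist (π v) (π w) - F (v - w)| ≤ K := fun v w => by
    rw [hπ]
    exact hKd v w
  have hF_le : ∀ v : E N, F v ≤ ‖v‖ := by
    refine le_norm_of_le_norm_add_const (K := K) hFsmul fun v => ?_
    have h1 := (abs_le.mp (hKd v 0)).1
    have h2 := ENNReal.toReal_mono (edist_ne_top v 0) (dbar_le_edist I v 0)
    rw [← dist_edist, dist_zero_right] at h2
    rw [sub_zero] at h1
    linarith
  have hlam_one : 1 ≤ lam := by
    have : Nonempty (Fin N) := ⟨⟨0, hN⟩⟩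
    obtain ⟨v, hv⟩ := exists_ne (0 : E N)
    have hF_pos : 0 < F v :=
      (nonneg_of_subadditive_of_abs_homogeneous hFadd hFsmul v).lt_of_ne'
        fun h => hv (hFdef v h)
    nlinarith [hlam v, hF_le v]
  have hbound : ε + ε / 2 ≤ √(8 * lam * r * ε + ε ^ 2) + ε := by
    have : ε / 2 ≤ √(8 * lam * r * ε + ε ^ 2) := by
      refine Real.le_sqrt_of_sq_le ?_
      have : 0 ≤ 8 * lam * r * ε := by positivity
      nlinarith
    linarith
  have hF_inv : ∀ v : E N, F (R⁻¹ • v) = F v / R := fun v => by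
    rw [hFsmul, abs_of_pos (inv_pos.mpr hR), inv_mul_eq_div]
  have hball : ∀ p : E N, F p ≤ R * r - K → π p ∈ closedBall (π 0) (R * r) := fun p hp => by
    have h := (abs_le.mp (hdbar p 0)).2
    rw [sub_zero] at h
    rw [mem_closedBall]
    linarith
  obtain ⟨Z, mZ, f, g, hf, hg, hfg⟩ :=
    @exists_isometries_hausdorffDist_le X (E N) (E N) (MetricSpace.divDist ‹_› R hR)
      (normMetric F hFadd hFsmul hFdef) _ π (fun p => R⁻¹ • p) (ε / 2) ε (by positivity) hε
      (fun p q => by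
        change |dist (π p) (π q) / R - F (R⁻¹ • p - R⁻¹ • q)| ≤ 2 * (ε / 2)
        rw [← smul_sub, hF_inv, ← sub_div, abs_div, abs_of_pos hR, mul_div_cancel₀ _ two_ne_zero]
        exact div_le_div_of_nonneg_right (hdbar p q) hR.le)
      hπsurj (closedBall (π 0) (R * r)) {v | F v ≤ r}
      (fun p hp => by
        refine exists_le_and_sub_le hr.le hε (by positivity) hFsmul ?_
        have h := (abs_le.mp (hdbar p 0)).1
        rw [mem_closedBall] at hp
        rw [sub_zero] at h
        rw [hF_inv, div_le_iff₀ hR, add_mul, hε_def, div_mul_cancel₀ _ hR.ne']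
        linarith)
      (fun v hv => by
        obtain ⟨u, hu, huv⟩ := exists_le_and_sub_le (r := r - ε) (by linarith) hε
          (by linarith) hFsmul (v := v) (by simpa using hv)
        refine ⟨R • u, hball _ ?_, ?_⟩
        · rw [hFsmul, abs_of_pos hR]
          have := mul_le_mul_of_nonneg_left hu hR.le
          rwa [mul_sub, hε_def, mul_div_cancel₀ _ hR.ne'] at this
        · change F (R⁻¹ • R • u - v) ≤ ε
          rwa [inv_smul_smul₀ hR.ne', ← neg_sub, map_neg_of_abs_homogeneous hFsmul])
  refine ⟨Z, mZ, f, g, fun x _ y _ => ?_, fun u _ v _ => ?_, hfg.trans hbound⟩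
  · exact @Isometry.dist_eq _ _ (_) _ _ hf x y
  · exact @Isometry.dist_eq _ _ (_) _ _ hg u v
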